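/- Let k ≥ 3 be an odd integer, N ≥ 3, and let G be a subgroup of SL(2,ℤ) with Γ(N) ⊆ G and −Id ∉ G. For a G-orbit O ⊆ Λ_N set F_O := Σ_{μ ∈ O} E_k(·, μ, N), and call O regular if O ∩ (−O) = ∅. Then: (a) F_O = 0 for every irregular orbit O (i.e. whenever O = −O); and (b) if S is a set of G-orbits in Λ_N containing exactly one member of each pair {O, −O} of regular orbits and no irregular orbits, then the family (F_O)_{O ∈ S} is linearly independent over ℂ and its ℂ-span equals {f ∈ span_ℂ{E_k(·, λ̄, N) : λ̄ ∈ Λ_N} : f|_k γ = f for all γ ∈ G}. -/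

import Mathlib

open scoped MatrixGroups
open Complex UpperHalfPlane

noncomputable section

abbrev SL2Z := Matrix.SpecialLinearGroup (Fin 2) ℤ

/-- weight `k` slash action of `γ ∈ SL(2,ℤ)` on functions `ℍ → ℂ`. -/
def slashf (k : ℤ) (γ : SL2Z) (f : ℍ → ℂ) : ℍ → ℂ :=
  fun τ => (((γ 1 0 : ℤ) : ℂ) * (τ : ℂ) + ((γ 1 1 : ℤ) : ℂ)) ^ (-k) * f (γ • τ)

/-- normalized Eisenstein series of weight `k` on `Γ(N)` -/
def Ek (k N : ℕ) (lam : ZMod N × ZMod N) : ℍ → ℂ :=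
  fun τ => (if 3 ≤ N then (1 : ℂ) else 1/2) * ∑' cd : ℤ × ℤ,
    if Int.gcd cd.1 cd.2 = 1 ∧ (cd.1 : ZMod N) = lam.1 ∧ (cd.2 : ZMod N) = lam.2
    then ((cd.1 : ℂ) * (τ : ℂ) + (cd.2 : ℂ)) ^ (-(k : ℤ)) else 0

/-- right action of `SL(2,ℤ)` on row vectors mod `N` -/
def rmul {N : ℕ} (lam : ZMod N × ZMod N) (γ : SL2Z) : ZMod N × ZMod N :=
  (lam.1 * ((γ 0 0 : ℤ) : ZMod N) + lam.2 * ((γ 1 0 : ℤ) : ZMod N),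
   lam.1 * ((γ 0 1 : ℤ) : ZMod N) + lam.2 * ((γ 1 1 : ℤ) : ZMod N))

/-- `-Id` in `SL(2,ℤ)` -/
def negId : SL2Z := ⟨!![-1, 0; 0, -1], by norm_num [Matrix.det_fin_two_of]⟩

/-- `O` is an orbit of the right `G`-action on `Λ_N` -/
def isOrbit (N : ℕ) (G : Subgroup SL2Z) (O : Set (ZMod N × ZMod N)) : Prop :=
  ∃ lam : ZMod N × ZMod N, addOrderOf lam = N ∧ O = {μ | ∃ γ ∈ G, rmul lam γ = μ}

/-- the orbital sum `F_O = Σ_{μ ∈ O} E_k(·,μ,N)`. -/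
def FO (k N : ℕ) (O : Set (ZMod N × ZMod N)) : ℍ → ℂ :=
  fun τ => ∑' μ : O, Ek k N (μ : ZMod N × ZMod N) τ

open scoped ModularForm
open Filter Topology

/-! ### Analytic properties of the Eisenstein series -/

lemma slashf_eq_slash (k : ℤ) (γ : SL2Z) (f : ℍ → ℂ) : slashf k γ f = f ∣[k] γ := by
  ext τ
  rw [ModularForm.SL_slash_apply, mul_comm]
  simp [slashf, denom]

lemma Ek_eq_eisensteinSeries {k N : ℕ} (hN : 3 ≤ N) (lam : ZMod N × ZMod N) :
    Ek k N lam = eisensteinSeries ![lam.1, lam.2] (k : ℤ) := by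
  ext τ
  rw [Ek, if_pos hN, one_mul, eisensteinSeries,
    tsum_subtype (EisensteinSeries.gammaSet N 1 ![lam.1, lam.2])
      (fun v => EisensteinSeries.eisSummand k v τ), ← (finTwoArrowEquiv ℤ).symm.tsum_eq]
  refine tsum_congr fun cd => ?_
  classical
  rw [Set.indicator_apply]
  refine if_congr ?_ ?_ rfl
  · simp [EisensteinSeries.gammaSet, funext_iff, and_comm]
  · simp [EisensteinSeries.eisSummand]

lemma slashf_Ek {k N : ℕ} (hN : 3 ≤ N) (lam : ZMod N × ZMod N) (γ : SL2Z) :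
    slashf k γ (Ek k N lam) = Ek k N (rmul lam γ) := by
  have : NeZero N := ⟨by lia⟩
  rw [slashf_eq_slash, Ek_eq_eisensteinSeries hN, Ek_eq_eisensteinSeries hN,
    EisensteinSeries.eisensteinSeries_slash_apply]
  congr 1
  ext i
  fin_cases i <;> simp [rmul, Matrix.vecMul, dotProduct]

lemma slashf_sum {ι : Type*} (k : ℤ) (γ : SL2Z) (s : Finset ι) (a : ι → ℂ) (f : ι → ℍ → ℂ) :
    slashf k γ (∑ i ∈ s, a i • f i) = ∑ i ∈ s, a i • slashf k γ (f i) := by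
  ext τ
  simp only [slashf, Finset.sum_apply, Pi.smul_apply, smul_eq_mul, Finset.mul_sum]
  exact Finset.sum_congr rfl fun i _ => by ring

lemma Ek_neg {k N : ℕ} (hko : Odd k) (lam : ZMod N × ZMod N) :
    Ek k N (-lam) = -Ek k N lam := by
  ext τ
  rw [Pi.neg_apply, Ek, Ek, ← mul_neg, ← tsum_neg, ← (Equiv.neg (ℤ × ℤ)).tsum_eq]
  congr 1
  refine tsum_congr fun cd => ?_
  have hk : Odd (-(k : ℤ)) := by simpa using hko
  have h : (-(cd.1 : ℂ) * (τ : ℂ) + -(cd.2 : ℂ)) = -((cd.1 : ℂ) * (τ : ℂ) + (cd.2 : ℂ)) := by ring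
  simp only [Equiv.neg_apply, Prod.fst_neg, Prod.snd_neg, Int.gcd_neg, Int.neg_gcd, Int.cast_neg,
    neg_inj, h, hk.neg_zpow]
  split_ifs <;> simp

/-- The points `(n + 1) i` of the upper half-plane. -/
def imagPoint (n : ℕ) : ℍ := ⟨(n + 1) * Complex.I, by simpa using n.cast_add_one_pos⟩

lemma imagPoint_mem_verticalStrip (n : ℕ) : imagPoint n ∈ verticalStrip 0 1 := by
  simp [mem_verticalStrip_iff, imagPoint]

lemma tendsto_linear_zpow_imagPoint {k : ℕ} (hk : 1 ≤ k) {c : ℤ} (hc : c ≠ 0) (d : ℤ) :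
    Tendsto (fun n => ((c : ℂ) * (imagPoint n : ℂ) + d) ^ (-(k : ℤ))) atTop (𝓝 0) := by
  refine squeeze_zero_norm (fun n => ?_) tendsto_one_div_add_atTop_nhds_zero_nat
  have hn : (n : ℝ) + 1 ≤ ‖(c : ℂ) * (imagPoint n : ℂ) + d‖ := by
    refine le_trans ?_ (Complex.abs_im_le_norm _)
    have h1 : (1 : ℝ) ≤ |(c : ℝ)| := by exact_mod_cast Int.one_le_abs hc
    have h2 : ((c : ℂ) * (imagPoint n : ℂ) + d).im = c * (n + 1) := by simp [imagPoint]
    rw [h2, abs_mul, abs_of_nonneg (by positivity : (0 : ℝ) ≤ n + 1)]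
    nlinarith [(Nat.cast_nonneg n : (0 : ℝ) ≤ n)]
  rw [zpow_neg, zpow_natCast, norm_inv, norm_pow, one_div]
  refine inv_anti₀ (by positivity) (hn.trans (le_self_pow₀ ?_ (by lia)))
  linarith [(Nat.cast_nonneg n : (0 : ℝ) ≤ n)]

lemma tendsto_Ek_imagPoint {k N : ℕ} (hk : 3 ≤ k) (hko : Odd k) (hN : 3 ≤ N)
    (lam : ZMod N × ZMod N) :
    Tendsto (fun n => Ek k N lam (imagPoint n)) atTop
      (𝓝 ((if lam = (0, 1) then 1 else 0) - (if lam = (0, -1) then 1 else 0))) := by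
  let g : ℤ × ℤ → ℂ := fun cd =>
    if cd.1 = 0 ∧ Int.gcd cd.1 cd.2 = 1 ∧ (cd.1 : ZMod N) = lam.1 ∧ (cd.2 : ZMod N) = lam.2
    then (cd.2 : ℂ) ^ (-(k : ℤ)) else 0
  have hg : ∑' cd, g cd =
      (if lam = (0, 1) then 1 else 0) - (if lam = (0, -1) then 1 else 0) := by
    rw [tsum_eq_sum (s := {(0, 1), (0, -1)})]
    · rw [Finset.sum_pair (by simp)]
      have hk' : Odd (-(k : ℤ)) := by simpa using hko
      simp only [g, Prod.ext_iff, Int.cast_neg, Int.cast_one, hk'.neg_one_zpow, one_zpow,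
        eq_comm (a := lam.1), eq_comm (a := lam.2)]
      split_ifs <;> simp_all [sub_eq_add_neg]
    · rintro ⟨c, d⟩ hcd
      refine if_neg ?_
      rintro ⟨rfl, h, -⟩
      rw [Int.gcd_zero_left] at h
      rcases Int.natAbs_eq_iff.mp h with rfl | rfl <;> simp at hcd
  rw [← hg]
  simp only [Ek, if_pos hN, one_mul]
  have hs : Summable fun cd : ℤ × ℤ =>
      EisensteinSeries.r ⟨⟨0, 1⟩, one_pos⟩ ^ (-(k : ℝ)) * ‖![cd.1, cd.2]‖ ^ (-(k : ℝ)) := by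
    refine Summable.mul_left _ ?_
    have := EisensteinSeries.summable_one_div_norm_rpow (k := k)
      (by exact_mod_cast (by lia : 2 < k))
    rw [← (finTwoArrowEquiv ℤ).symm.summable_iff] at this
    exact this
  refine tendsto_tsum_of_dominated_convergence hs (fun cd => ?_)
    (Eventually.of_forall fun n cd => ?_)
  · by_cases h : Int.gcd cd.1 cd.2 = 1 ∧ (cd.1 : ZMod N) = lam.1 ∧ (cd.2 : ZMod N) = lam.2
    · by_cases hc : cd.1 = 0
      · simp only [g, if_pos h, if_pos (And.intro hc h)]
        simp [hc]
      · simp only [g, if_pos h, hc, false_and, if_false]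
        exact tendsto_linear_zpow_imagPoint (by lia) hc _
    · simp [g, h]
  · split_ifs
    · have := EisensteinSeries.summand_bound_of_mem_verticalStrip
        (Nat.cast_nonneg k) ![cd.1, cd.2] one_pos (imagPoint_mem_verticalStrip n)
      refine le_of_eq_of_le ?_ this
      rw [norm_zpow, Real.rpow_neg (norm_nonneg _), Real.rpow_natCast, zpow_neg, zpow_natCast]
      simp
    · rw [norm_zero]
      have := EisensteinSeries.r_pos ⟨⟨0, 1⟩, one_pos⟩
      positivity

/-! ### The action of `SL(2, ℤ)` on row vectors modulo `N` -/

section RowVectors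

variable {N : ℕ}

lemma rmul_one (lam : ZMod N × ZMod N) : rmul lam 1 = lam := by
  simp [rmul]

lemma rmul_mul (lam : ZMod N × ZMod N) (γ δ : SL2Z) :
    rmul lam (γ * δ) = rmul (rmul lam γ) δ := by
  ext <;> simp [rmul, Matrix.mul_apply, Fin.sum_univ_two] <;> ring

lemma rmul_neg (lam : ZMod N × ZMod N) (γ : SL2Z) : rmul (-lam) γ = -rmul lam γ := by
  ext <;> simp [rmul] <;> ring

/-- Right multiplication by a fixed matrix as an additive automorphism. -/
def rmulEquiv (γ : SL2Z) : ZMod N × ZMod N ≃+ ZMod N × ZMod N where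
  toFun lam := rmul lam γ
  invFun lam := rmul lam γ⁻¹
  left_inv lam := by simp only [← rmul_mul, mul_inv_cancel, rmul_one]
  right_inv lam := by simp only [← rmul_mul, inv_mul_cancel, rmul_one]
  map_add' lam mu := by ext <;> simp [rmul] <;> ring

lemma rmulEquiv_apply (γ : SL2Z) (lam : ZMod N × ZMod N) : rmulEquiv γ lam = rmul lam γ := rfl

lemma addOrderOf_rmul (lam : ZMod N × ZMod N) (γ : SL2Z) :
    addOrderOf (rmul lam γ) = addOrderOf lam :=
  (rmulEquiv γ).addOrderOf_eq lam

/-- A natural number `a` with `gcd(a, b, N) = 1` is congruent modulo `N` to an integer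
coprime to `b`. -/
lemma exists_coprime_lift {a b N : ℕ} (hN : N ≠ 0) (hb : b ≠ 0)
    (h : Nat.Coprime (Nat.gcd a N) b) : ∃ c : ℕ, (c : ZMod N) = a ∧ Nat.Coprime c b := by
  obtain ⟨g, a', N', hg, hco, rfl, rfl⟩ := Nat.exists_coprime' (m := a) (n := N)
    (Nat.gcd_pos_of_pos_right _ (Nat.pos_of_ne_zero hN))
  have hN' : N' ≠ 0 := by rintro rfl; simp at hN
  rw [Nat.gcd_mul_right, hco.gcd_eq_one, one_mul] at h
  have : NeZero (N' * b) := ⟨by positivity⟩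
  obtain ⟨u, hu⟩ := ZMod.unitsMap_surjective (Dvd.intro b rfl : N' ∣ N' * b)
    (ZMod.unitOfCoprime a' hco)
  refine ⟨u.val.val * g, ?_, ?_⟩
  · rw [ZMod.natCast_eq_natCast_iff]
    refine Nat.ModEq.mul_right' g ?_
    rw [← ZMod.natCast_eq_natCast_iff]
    have := congrArg Units.val hu
    rw [ZMod.unitsMap_val] at this
    simpa using this
  · exact ((ZMod.val_coe_unit_coprime u).coprime_dvd_right (Dvd.intro_left N' rfl)).mul_left h

/-- `SL(2, ℤ)` acts transitively on the row vectors of additive order `N`. -/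
lemma exists_rmul_eq (hN : N ≠ 0) {lam : ZMod N × ZMod N} (h : addOrderOf lam = N) :
    ∃ σ : SL2Z, rmul (0, 1) σ = lam := by
  have : NeZero N := ⟨hN⟩
  obtain ⟨a, b⟩ := lam
  have hbv : ((b.val + N : ℕ) : ZMod N) = b := by simp
  have hco : Nat.Coprime (Nat.gcd a.val N) (b.val + N) := by
    set e := Nat.gcd (Nat.gcd a.val N) (b.val + N) with he
    have heN : e ∣ N := (Nat.gcd_dvd_left _ _).trans (Nat.gcd_dvd_right _ _)
    have hea : e ∣ a.val := (Nat.gcd_dvd_left _ _).trans (Nat.gcd_dvd_left _ _)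
    have heb : e ∣ b.val + N := Nat.gcd_dvd_right _ _
    obtain ⟨m, hm⟩ := heN
    have key {x : ℕ} (hx : e ∣ x) : (m : ZMod N) * (x : ZMod N) = 0 := by
      rw [← Nat.cast_mul, ZMod.natCast_eq_zero_iff]
      conv_lhs => rw [hm]
      rw [mul_comm m x]
      exact Nat.mul_dvd_mul_right hx m
    have hdvd : addOrderOf (a, b) ∣ m := by
      rw [addOrderOf_dvd_iff_nsmul_eq_zero]
      have h1 := key hea
      have h2 := key heb
      rw [hbv] at h2
      rw [ZMod.natCast_zmod_val] at h1
      simp [Prod.ext_iff, h1, h2]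
    rw [h] at hdvd
    have hm0 : 0 < m := Nat.pos_of_ne_zero (by rintro rfl; simp at hm; exact hN hm)
    have h3 := Nat.le_of_dvd hm0 hdvd
    have : e ≠ 0 := by rintro h0; rw [h0] at hm; simp at hm; exact hN hm
    change e = 1
    nlinarith [Nat.pos_of_ne_zero this]
  obtain ⟨c, hc, hcop⟩ := exists_coprime_lift hN (by positivity) hco
  obtain ⟨σ, h0, h1⟩ := (Nat.isCoprime_iff_coprime.mpr hcop).exists_SL2_row 1
  refine ⟨σ, ?_⟩
  ext
  · simp [rmul, h0, hc]
  · simp only [rmul, h1]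
    simp

end RowVectors

/-! ### Orbits and orbital sums -/

section Orbits

variable {N : ℕ} {G : Subgroup SL2Z} {O O' : Set (ZMod N × ZMod N)} {mu : ZMod N × ZMod N}

lemma mem_image_neg : mu ∈ (fun μ : ZMod N × ZMod N => -μ) '' O ↔ -mu ∈ O := by
  simp

lemma isOrbit.addOrderOf_eq (hO : isOrbit N G O) (hmu : mu ∈ O) : addOrderOf mu = N := by
  obtain ⟨lam, hlam, rfl⟩ := hO
  obtain ⟨γ, -, rfl⟩ := hmu
  rw [addOrderOf_rmul, hlam]

lemma isOrbit.rmul_mem_iff (hO : isOrbit N G O) {γ : SL2Z} (hγ : γ ∈ G) :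
    rmul mu γ ∈ O ↔ mu ∈ O := by
  obtain ⟨lam, -, rfl⟩ := hO
  constructor
  · rintro ⟨δ, hδ, h⟩
    exact ⟨δ * γ⁻¹, G.mul_mem hδ (G.inv_mem hγ), by
      rw [rmul_mul, h, ← rmul_mul, mul_inv_cancel, rmul_one]⟩
  · rintro ⟨δ, hδ, rfl⟩
    exact ⟨δ * γ, G.mul_mem hδ hγ, rmul_mul _ _ _⟩

lemma isOrbit.eq_of_mem (hO : isOrbit N G O) (hmu : mu ∈ O) :
    O = {ν | ∃ γ ∈ G, rmul mu γ = ν} := by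
  refine Set.Subset.antisymm ?_ ?_
  · obtain ⟨lam, -, rfl⟩ := hO
    obtain ⟨δ, hδ, rfl⟩ := hmu
    rintro _ ⟨γ, hγ, rfl⟩
    exact ⟨δ⁻¹ * γ, G.mul_mem (G.inv_mem hδ) hγ, by rw [← rmul_mul, mul_inv_cancel_left]⟩
  · rintro _ ⟨γ, hγ, rfl⟩
    exact (hO.rmul_mem_iff hγ).mpr hmu

lemma isOrbit.eq_of_mem_of_mem (hO : isOrbit N G O) (hO' : isOrbit N G O') (h : mu ∈ O)
    (h' : mu ∈ O') : O = O' :=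
  (hO.eq_of_mem h).trans (hO'.eq_of_mem h').symm

lemma isOrbit.image_neg (hO : isOrbit N G O) :
    isOrbit N G ((fun μ : ZMod N × ZMod N => -μ) '' O) := by
  obtain ⟨lam, hlam, rfl⟩ := hO
  refine ⟨-lam, by rw [addOrderOf_neg, hlam], ?_⟩
  ext ν
  simp only [mem_image_neg, Set.mem_ofPred_eq, rmul_neg, neg_eq_iff_eq_neg]

variable [NeZero N] {k : ℕ}

lemma FO_eq_sum_indicator (O : Set (ZMod N × ZMod N)) :
    FO k N O = ∑ μ, O.indicator (fun _ => (1 : ℂ)) μ • Ek k N μ := by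
  ext τ
  rw [FO, tsum_subtype O (fun μ => Ek k N μ τ), tsum_fintype, Finset.sum_apply]
  refine Finset.sum_congr rfl fun μ _ => ?_
  by_cases h : μ ∈ O <;> simp [h]

lemma FO_image_neg (hko : Odd k) (O : Set (ZMod N × ZMod N)) :
    FO k N ((fun μ : ZMod N × ZMod N => -μ) '' O) = -FO k N O := by
  rw [FO_eq_sum_indicator, FO_eq_sum_indicator,
    ← Fintype.sum_equiv (Equiv.neg _) _ _ fun _ => rfl, ← Finset.sum_neg_distrib]
  refine Finset.sum_congr rfl fun μ _ => ?_
  by_cases h : μ ∈ O <;> simp [h, Ek_neg hko]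

lemma FO_eq_zero_of_eq_image_neg (hko : Odd k)
    (h : O = (fun μ : ZMod N × ZMod N => -μ) '' O) : FO k N O = 0 := by
  rw [← self_eq_neg, ← FO_image_neg hko, ← h]

lemma isOrbit.slashf_FO (hN : 3 ≤ N) (hO : isOrbit N G O) {γ : SL2Z} (hγ : γ ∈ G) :
    slashf k γ (FO k N O) = FO k N O := by
  rw [FO_eq_sum_indicator, slashf_sum]
  conv_rhs => rw [← (rmulEquiv γ).toEquiv.sum_comp]
  refine Finset.sum_congr rfl fun μ _ => ?_
  have : O.indicator (fun _ => (1 : ℂ)) (rmul μ γ) = O.indicator (fun _ => (1 : ℂ)) μ := by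
    by_cases h : μ ∈ O <;> simp [h, hO.rmul_mem_iff hγ]
  simp [rmulEquiv_apply, slashf_Ek hN, this]

lemma isOrbit.FO_mem_span (hO : isOrbit N G O) :
    FO k N O ∈ Submodule.span ℂ
      {g : ℍ → ℂ | ∃ lam : ZMod N × ZMod N, addOrderOf lam = N ∧ g = Ek k N lam} := by
  rw [FO_eq_sum_indicator]
  refine Submodule.sum_mem _ fun μ _ => ?_
  by_cases h : μ ∈ O
  · exact Submodule.smul_mem _ _ (Submodule.subset_span ⟨μ, hO.addOrderOf_eq h, rfl⟩)
  · simp [h]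

/-- Linear relations between the Eisenstein series of odd weight have even coefficients. -/
lemma coeff_eq_coeff_neg_of_sum_eq_zero (hk : 3 ≤ k) (hko : Odd k) (hN : 3 ≤ N)
    {c : ZMod N × ZMod N → ℂ} (h : ∑ μ, c μ • Ek k N μ = 0) {lam : ZMod N × ZMod N}
    (hlam : addOrderOf lam = N) : c lam = c (-lam) := by
  obtain ⟨σ, rfl⟩ := exists_rmul_eq (NeZero.ne N) hlam
  have h0 : ∑ μ, c (rmul μ σ) • Ek k N μ = 0 := by
    have h1 := congrArg (slashf k σ⁻¹) h
    rw [slashf_sum, ← (rmulEquiv σ).toEquiv.sum_comp] at h1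
    simp only [slashf_Ek hN, AddEquiv.toEquiv_eq_coe, AddEquiv.coe_toEquiv, rmulEquiv_apply,
      ← rmul_mul, mul_inv_cancel, rmul_one] at h1
    rw [h1]
    ext τ
    simp [slashf]
  have h2 := tendsto_finsetSum (Finset.univ : Finset (ZMod N × ZMod N)) fun μ _ =>
    (tendsto_Ek_imagPoint hk hko hN μ).const_mul (c (rmul μ σ))
  have h3 : ∀ n, ∑ μ, c (rmul μ σ) * Ek k N μ (imagPoint n) = 0 := fun n => by
    simpa using congrFun h0 (imagPoint n)
  simp only [h3, mul_sub, Finset.sum_sub_distrib, mul_ite, mul_one, mul_zero, Finset.sum_ite_eq',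
    Finset.mem_univ, if_true] at h2
  have h4 := tendsto_nhds_unique h2 tendsto_const_nhds
  have h5 : ((0, -1) : ZMod N × ZMod N) = -(0, 1) := by simp
  rw [h5, rmul_neg] at h4
  exact sub_eq_zero.mp h4

/-- Every element of the Eisenstein space of odd weight is a combination of Eisenstein series
with odd coefficients supported on the vectors of order `N`. -/
lemma exists_odd_coeff_of_mem_span (hko : Odd k) {f : ℍ → ℂ}
    (hf : f ∈ Submodule.span ℂ
      {g : ℍ → ℂ | ∃ lam : ZMod N × ZMod N, addOrderOf lam = N ∧ g = Ek k N lam}) :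
    ∃ b : ZMod N × ZMod N → ℂ, (∀ μ, addOrderOf μ ≠ N → b μ = 0) ∧ (∀ μ, b (-μ) = -b μ) ∧
      f = ∑ μ, b μ • Ek k N μ := by
  classical
  induction hf using Submodule.span_induction with
  | mem x hx =>
    obtain ⟨lam, hlam, rfl⟩ := hx
    refine ⟨fun μ => (if μ = lam then 1 / 2 else 0) - if μ = -lam then 1 / 2 else 0,
      fun μ hμ => ?_, fun μ => ?_, ?_⟩
    · have h1 : μ ≠ lam := by rintro rfl; exact hμ hlam
      have h2 : μ ≠ -lam := by rintro rfl; exact hμ (by rw [addOrderOf_neg, hlam])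
      simp [h1, h2]
    · simp only [neg_eq_iff_eq_neg, neg_neg]
      ring
    · simp only [sub_smul, ite_smul, zero_smul, Finset.sum_sub_distrib, Finset.sum_ite_eq',
        Finset.mem_univ, if_true, Ek_neg hko]
      module
  | zero => exact ⟨0, by simp, by simp, by simp⟩
  | add x y _ _ hx hy =>
    obtain ⟨b, hb, hb', rfl⟩ := hx
    obtain ⟨c, hc, hc', rfl⟩ := hy
    refine ⟨b + c, fun μ hμ => by simp [hb μ hμ, hc μ hμ], fun μ => ?_, ?_⟩
    · simp [hb', hc', add_comm]
    · simp [add_smul, Finset.sum_add_distrib]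
  | smul a x _ hx =>
    obtain ⟨b, hb, hb', rfl⟩ := hx
    exact ⟨a • b, fun μ hμ => by simp [hb μ hμ], fun μ => by simp [hb'],
      by simp [mul_smul, Finset.smul_sum]⟩

lemma coeff_rmul_of_slashf_eq (hk : 3 ≤ k) (hko : Odd k) (hN : 3 ≤ N)
    {b : ZMod N × ZMod N → ℂ} (hsupp : ∀ μ, addOrderOf μ ≠ N → b μ = 0)
    (hodd : ∀ μ, b (-μ) = -b μ) {γ : SL2Z}
    (h : slashf k γ (∑ μ, b μ • Ek k N μ) = ∑ μ, b μ • Ek k N μ) (mu : ZMod N × ZMod N) :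
    b (rmul mu γ) = b mu := by
  by_cases hmu : addOrderOf mu = N
  · have h0 : ∑ μ, (b (rmul μ γ⁻¹) - b μ) • Ek k N μ = 0 := by
      simp only [sub_smul, Finset.sum_sub_distrib]
      rw [sub_eq_zero, ← h, slashf_sum, ← (rmulEquiv γ).toEquiv.sum_comp]
      simp only [slashf_Ek hN, AddEquiv.toEquiv_eq_coe, AddEquiv.coe_toEquiv, rmulEquiv_apply,
        ← rmul_mul, mul_inv_cancel, rmul_one]
    have h1 := coeff_eq_coeff_neg_of_sum_eq_zero hk hko hN h0
      (lam := rmul mu γ) (by rw [addOrderOf_rmul, hmu])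
    simp only [rmul_neg, hodd, ← rmul_mul, mul_inv_cancel, rmul_one] at h1
    linear_combination (-1 / 2) * h1
  · rw [hsupp _ hmu, hsupp]
    rwa [addOrderOf_rmul]

/-- A combination of Eisenstein series with `G`-invariant coefficients is a combination of
orbital sums. -/
lemma sum_smul_Ek_mem_span_FO {b : ZMod N × ZMod N → ℂ}
    (hsupp : ∀ μ, addOrderOf μ ≠ N → b μ = 0) (hinv : ∀ γ ∈ G, ∀ μ, b (rmul μ γ) = b μ) :
    ∑ μ, b μ • Ek k N μ ∈ Submodule.span ℂ {g : ℍ → ℂ | ∃ O, isOrbit N G O ∧ g = FO k N O} := by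
  classical
  let orb : ZMod N × ZMod N → Set (ZMod N × ZMod N) := fun μ => {ν | ∃ γ ∈ G, rmul μ γ = ν}
  rw [← Finset.sum_filter_of_ne (p := fun μ => addOrderOf μ = N)
      (fun μ _ h => by by_contra h'; exact h (by rw [hsupp μ h', zero_smul])),
    ← Finset.sum_fiberwise_of_maps_to (g := orb) (fun μ hμ => Finset.mem_image_of_mem orb hμ)]
  refine Submodule.sum_mem _ fun O hO => ?_
  obtain ⟨lam, hlam, rfl⟩ := Finset.mem_image.mp hO
  have hlam' : addOrderOf lam = N := (Finset.mem_filter.mp hlam).2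
  have horb : isOrbit N G (orb lam) := ⟨lam, hlam', rfl⟩
  have hsum : ∑ μ ∈ Finset.univ.filter (fun μ => addOrderOf μ = N) with orb μ = orb lam,
      b μ • Ek k N μ = b lam • FO k N (orb lam) := by
    rw [FO_eq_sum_indicator, Finset.smul_sum, Finset.filter_filter, Finset.sum_filter]
    refine Finset.sum_congr rfl fun μ _ => ?_
    by_cases h : μ ∈ orb lam
    · have h1 := (horb.eq_of_mem h).symm
      rw [if_pos ⟨horb.addOrderOf_eq h, h1⟩]
      obtain ⟨γ, hγ, rfl⟩ := h
      rw [hinv γ hγ, Set.indicator_of_mem (show rmul lam γ ∈ orb lam from ⟨γ, hγ, rfl⟩), one_smul]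
    · have h1 : orb μ ≠ orb lam := fun h1 => h (h1 ▸ ⟨1, G.one_mem, rmul_one μ⟩)
      simp [h, h1]
  rw [hsum]
  exact Submodule.smul_mem _ _ (Submodule.subset_span ⟨_, horb, rfl⟩)

lemma linearIndependent_FO (hk : 3 ≤ k) (hko : Odd k) (hN : 3 ≤ N)
    {S : Set (Set (ZMod N × ZMod N))} (hS : ∀ O ∈ S, isOrbit N G O)
    (hneg : ∀ O ∈ S, (fun μ : ZMod N × ZMod N => -μ) '' O ∉ S) :
    LinearIndependent ℂ (fun O : S => FO k N O) := by
  classical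
  rw [linearIndependent_iff']
  intro s g hg O hO
  have h0 : ∑ μ, (∑ P ∈ s, g P * (P : Set (ZMod N × ZMod N)).indicator (fun _ => (1 : ℂ)) μ) •
      Ek k N μ = 0 := by
    rw [← hg]
    simp only [FO_eq_sum_indicator, Finset.smul_sum, Finset.sum_smul, mul_smul]
    exact Finset.sum_comm
  obtain ⟨lam, hlam⟩ : (O : Set (ZMod N × ZMod N)).Nonempty := by
    obtain ⟨lam, -, h⟩ := hS O O.2
    exact ⟨lam, h ▸ ⟨1, G.one_mem, rmul_one lam⟩⟩
  have h1 := coeff_eq_coeff_neg_of_sum_eq_zero hk hko hN h0 ((hS O O.2).addOrderOf_eq hlam)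
  rw [Finset.sum_eq_single_of_mem O hO, Finset.sum_eq_zero] at h1
  · simpa [hlam] using h1
  · intro P _
    rw [Set.indicator_of_notMem, mul_zero]
    intro hP
    refine hneg O O.2 ?_
    rw [(hS O O.2).image_neg.eq_of_mem_of_mem (hS P P.2) (by simpa [mem_image_neg] using hlam) hP]
    exact P.2
  · intro P _ hPO
    rw [Set.indicator_of_notMem, mul_zero]
    intro hP
    exact hPO (Subtype.ext ((hS P P.2).eq_of_mem_of_mem (hS O O.2) hP hlam))

lemma isOrbit.FO_mem_span_range (hko : Odd k) {S : Set (Set (ZMod N × ZMod N))}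
    (hS : ∀ O : Set (ZMod N × ZMod N), isOrbit N G O →
        O ∩ ((fun μ : ZMod N × ZMod N => -μ) '' O) = ∅ →
        (O ∈ S ↔ ((fun μ : ZMod N × ZMod N => -μ) '' O) ∉ S)) (hO : isOrbit N G O) :
    FO k N O ∈ Submodule.span ℂ (Set.range (fun O : S => FO k N O)) := by
  by_cases hreg : O ∩ ((fun μ : ZMod N × ZMod N => -μ) '' O) = ∅
  · by_cases hOS : O ∈ S
    · exact Submodule.subset_span ⟨⟨O, hOS⟩, rfl⟩
    · rw [hS O hO hreg, not_not] at hOS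
      rw [← neg_neg (FO k N O), ← FO_image_neg hko]
      exact Submodule.neg_mem _ (Submodule.subset_span ⟨⟨_, hOS⟩, rfl⟩)
  · obtain ⟨μ, h, h'⟩ := Set.nonempty_iff_ne_empty.mpr hreg
    rw [FO_eq_zero_of_eq_image_neg hko (hO.eq_of_mem_of_mem hO.image_neg h h')]
    exact Submodule.zero_mem _

end Orbits

/-- For odd `k ≥ 3`, `N ≥ 3`, `Γ(N) ⊆ G`, `-Id ∉ G`:
(a) the orbital sum of any irregular `G`-orbit vanishes; (b) picking one orbit from
each pair `{O, -O}` of regular orbits yields a linearly independent family spanning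
the `G`-invariant weight-`k` Eisenstein series. -/
theorem spectral_basis_odd (k N : ℕ) (hk : 3 ≤ k) (hko : Odd k) (hN : 3 ≤ N)
    (G : Subgroup SL2Z) (hG : CongruenceSubgroup.Gamma N ≤ G) (hneg : negId ∉ G) :
    (∀ O : Set (ZMod N × ZMod N), isOrbit N G O →
      O = (fun μ : ZMod N × ZMod N => -μ) '' O → FO k N O = 0) ∧
    (∀ S : Set (Set (ZMod N × ZMod N)),
      (∀ O ∈ S, isOrbit N G O) →
      (∀ O ∈ S, O ∩ ((fun μ : ZMod N × ZMod N => -μ) '' O) = ∅) →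
      (∀ O : Set (ZMod N × ZMod N), isOrbit N G O →
        O ∩ ((fun μ : ZMod N × ZMod N => -μ) '' O) = ∅ →
        (O ∈ S ↔ ((fun μ : ZMod N × ZMod N => -μ) '' O) ∉ S)) →
      (LinearIndependent ℂ (fun O : S => FO k N O) ∧
        (Submodule.span ℂ (Set.range (fun O : S => FO k N O)) : Set (ℍ → ℂ)) =
          {f : ℍ → ℂ | f ∈ Submodule.span ℂ
              {g : ℍ → ℂ | ∃ lam : ZMod N × ZMod N, addOrderOf lam = N ∧ g = Ek k N lam} ∧
            ∀ γ ∈ G, slashf (k : ℤ) γ f = f})) := by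
  have : NeZero N := ⟨by lia⟩
  refine ⟨fun O _ h => FO_eq_zero_of_eq_image_neg hko h, fun S hS hreg hpair =>
    ⟨linearIndependent_FO hk hko hN hS fun O hO => (hpair O (hS O hO) (hreg O hO)).mp hO, ?_⟩⟩
  refine Set.Subset.antisymm (fun f hf => ?_) ?_
  · refine ⟨Submodule.span_le.mpr ?_ hf, fun γ hγ => ?_⟩
    · rintro _ ⟨O, rfl⟩
      exact (hS O O.2).FO_mem_span
    · obtain ⟨c, rfl⟩ := (Finsupp.mem_span_range_iff_exists_finsupp).mp hf
      rw [Finsupp.sum, slashf_sum]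
      exact Finset.sum_congr rfl fun O _ => by rw [(hS O O.2).slashf_FO hN hγ]
  · rintro f ⟨hf, hinv⟩
    obtain ⟨b, hsupp, hodd, rfl⟩ := exists_odd_coeff_of_mem_span hko hf
    refine Submodule.span_le.mpr ?_ (sum_smul_Ek_mem_span_FO (G := G) hsupp fun γ hγ =>
      coeff_rmul_of_slashf_eq hk hko hN hsupp hodd (hinv γ hγ))
    rintro _ ⟨O, hO, rfl⟩
    exact hO.FO_mem_span_range hko hpair
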